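/- Let m ∈ ℕ and let X be an ℝ^m-system (not necessarily ergodic). Then there exists an at most countable family (ℓ_j)_{j∈J} of hyperplanes of ℝ^m such that for every α ∈ ℝ^m with α ∉ ⋃_{j∈J} ℓ_j, one has I({nα : n ∈ ℤ}) = I(ℝ^m). -/

import Mathlib

open MeasureTheory Filter Topology

structure RSystem (m : ℕ) (X : Type*) [MeasurableSpace X] (μ : Measure X) where
  T : (Fin m → ℝ) → X → X
  measurable_pair : Measurable fun p : (Fin m → ℝ) × X => T p.1 p.2
  measurePreserving : ∀ α, MeasurePreserving (T α) μ μ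
  T_zero : T 0 = id
  T_add : ∀ α β, T α ∘ T β = T (α + β)
  separableL2 : TopologicalSpace.SeparableSpace (Lp ℂ 2 μ)

namespace RSystem

variable {m : ℕ} {X : Type*} [MeasurableSpace X] {μ : Measure X}

/-- The system is ergodic. -/
def IsErgodic (S : RSystem m X μ) : Prop :=
  ∀ A : Set X, MeasurableSet A → (∀ α, μ (symmDiff (S.T α ⁻¹' A) A) = 0) →
    μ A = 0 ∨ μ A = 1

end RSystem

/-- A set of reals has density one. -/
def HasDensityOne (A : Set ℝ) : Prop :=
  Tendsto (fun T' : ℝ => (volume (A ∩ Set.Icc 0 T')).toReal / T') atTop (nhds 1)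

namespace RSystem

variable {m : ℕ} {X : Type*} [MeasurableSpace X] {μ : Measure X}

/-- `ν` is weakly equidistributed for the system. -/
def WeaklyEquidistributed (S : RSystem m X μ) (ν : Measure (Fin m → ℝ)) : Prop :=
  ∃ A : Set ℝ, MeasurableSet A ∧ HasDensityOne A ∧
    ∀ f : X → ℂ, Measurable f → (∃ C, ∀ x, ‖f x‖ ≤ C) →
      ∀ᵐ x ∂μ, Tendsto (fun t : ℝ => ∫ α, f (S.T (t • α) x) ∂ν)
        (atTop ⊓ Filter.principal A) (nhds (∫ x, f x ∂μ))

/-- The system is good for double Birkhoff averages. -/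
def GoodForDoubleBirkhoff (S : RSystem m X μ) : Prop :=
  ∀ (f₁ f₂ : X → ℂ), Measurable f₁ → Measurable f₂ →
    (∃ C, ∀ x, ‖f₁ x‖ ≤ C) → (∃ C, ∀ x, ‖f₂ x‖ ≤ C) →
    ∀ α₁ α₂ : Fin m → ℝ, ∀ᵐ x ∂μ, ∃ L : ℂ,
      Tendsto (fun T' : ℝ => (1 / T' : ℝ) •
          ∫ t in Set.Ioc (0:ℝ) T', f₁ (S.T (t • α₁) x) * f₂ (S.T (t • α₂) x))
        atTop (nhds L)

/-- The σ-algebra (collection of sets) invariant under `T_g`, `g ∈ H`, up to null sets. -/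
def InvSets (S : RSystem m X μ) (H : Set (Fin m → ℝ)) : Set (Set X) :=
  {A | MeasurableSet A ∧ ∀ g ∈ H, μ (symmDiff (S.T g ⁻¹' A) A) = 0}

/-- The set of non-ergodic directions. -/
def W (S : RSystem m X μ) : Set (Fin m → ℝ) :=
  {α | S.InvSets (Set.range fun t : ℝ => t • α) ≠ S.InvSets Set.univ}

end RSystem

/-- A hyperplane of `ℝ^m`: a translate of an `(m-1)`-dimensional linear subspace. -/
def IsHyperplane (m : ℕ) (ℓ : Set (Fin m → ℝ)) : Prop :=
  ∃ (V : Submodule ℝ (Fin m → ℝ)) (β : Fin m → ℝ),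
    Module.finrank ℝ V = m - 1 ∧ ℓ = (fun v => v + β) '' (V : Set (Fin m → ℝ))

open scoped FourierTransform

/-- A measurable bounded function whose Fourier coefficients on `(0, 1]` all vanish is zero almost
everywhere there. -/
theorem ae_eq_zero_of_forall_integral_fourierChar_eq_zero {φ : ℝ → ℂ} (hφ : Measurable φ) {C : ℝ}
    (hC : ∀ t, ‖φ t‖ ≤ C) (h : ∀ n : ℤ, ∫ t in (0 : ℝ)..1, (𝐞 (n * t) : ℂ) * φ t = 0) :
    ∀ᵐ t ∂volume.restrict (Set.Ioc (0 : ℝ) 1), φ t = 0 := by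
  have hL2 : MemLp φ 2 (volume.restrict (Set.Ioc (0 : ℝ) 1)) :=
    MemLp.of_bound hφ.aestronglyMeasurable C (ae_of_all _ hC)
  have hcoeff : ∀ n : ℤ, fourierCoeffOn zero_lt_one φ n = 0 := fun n => by
    have hn : ∀ t : ℝ, fourier (-n) (t : AddCircle ((1 : ℝ) - 0)) • φ t
        = (𝐞 ((-n : ℤ) * t) : ℂ) * φ t := fun t => by
      rw [fourier_coe_apply, Real.fourierChar_apply, smul_eq_mul]
      congr 2
      push_cast
      ring
    rw [fourierCoeffOn_eq_integral]
    simp_rw [hn]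
    rw [h (-n), smul_zero]
  have hsum := hasSum_sq_fourierCoeffOn zero_lt_one hL2
  simp only [hcoeff, norm_zero, ne_eq, OfNat.ofNat_ne_zero, not_false_eq_true, zero_pow, sub_zero,
    inv_one, one_smul] at hsum
  have hzero : ∫ t in Set.Ioc (0 : ℝ) 1, ‖φ t‖ ^ 2 = 0 := by
    rw [← intervalIntegral.integral_of_le zero_le_one]
    exact hsum.unique hasSum_zero
  have := (integral_eq_zero_iff_of_nonneg (fun t => sq_nonneg _)
    ((memLp_two_iff_integrable_sq_norm hL2.1).1 hL2)).1 hzero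
  filter_upwards [this] with t ht
  simpa using ht

theorem eq_zero_of_forall_fourierChar_mul_eq_one {c : ℝ} (h : ∀ t : ℝ, 𝐞 (t * c) = 1) : c = 0 := by
  by_contra hc
  have := congrArg (fun z : Circle => (z : ℂ)) (h (1 / (2 * c)))
  simp only [Real.fourierChar_apply, Circle.coe_one] at this
  rw [show 2 * Real.pi * (1 / (2 * c) * c) = Real.pi by field_simp, Complex.exp_pi_mul_I] at this
  norm_num at this

section JointEigenspaces

variable {E : Type*}
  {H : Type*} [NormedAddCommGroup H] [InnerProductSpace ℂ H]

/-- The vectors fixed by every `U w`. -/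
noncomputable def fixedSubspace (U : E → H →ₗᵢ[ℂ] H) : Submodule ℂ H where
  carrier := {f | ∀ w, U w f = f}
  add_mem' hf hg w := by rw [map_add, hf w, hg w]
  zero_mem' w := map_zero _
  smul_mem' c f hf w := by rw [map_smul, hf w]

variable {U : E → H →ₗᵢ[ℂ] H}

theorem isClosed_fixedSubspace : IsClosed (fixedSubspace U : Set H) := by
  have : (fixedSubspace U : Set H) = ⋂ w, {f | U w f = f} := by
    ext f; simp [fixedSubspace]
  rw [this]
  exact isClosed_iInter fun w => isClosed_eq (U w).continuous continuous_id

variable [AddCommGroup E]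

theorem apply_zero_of_map_add (hU : ∀ a b x, U (a + b) x = U a (U b x)) (x : H) : U 0 x = x :=
  (U 0).injective (by rw [← hU, add_zero])

theorem inner_apply_left (hU : ∀ a b x, U (a + b) x = U a (U b x)) (a : E) (x y : H) :
    inner ℂ (U a x) y = inner ℂ x (U (-a) y) := by
  rw [← (U (-a)).inner_map_map (U a x) y, ← hU, neg_add_cancel, apply_zero_of_map_add hU]

theorem apply_mem_orthogonal_of_forall_apply_mem (hU : ∀ a b x, U (a + b) x = U a (U b x))
    {A : Submodule ℂ H} (hA : ∀ a, ∀ x ∈ A, U a x ∈ A) (a : E) {x : H} (hx : x ∈ Aᗮ) :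
    U a x ∈ Aᗮ := by
  rw [Submodule.mem_orthogonal'] at hx ⊢
  intro y hy
  rw [inner_apply_left hU]
  exact hx _ (hA _ _ hy)

theorem apply_mem_fixedSubspace_orthogonal (hU : ∀ a b x, U (a + b) x = U a (U b x)) (a : E) {x : H}
    (hx : x ∈ (fixedSubspace U)ᗮ) : U a x ∈ (fixedSubspace U)ᗮ :=
  apply_mem_orthogonal_of_forall_apply_mem hU (fun a y hy => by rwa [hy a]) a hx

/-- The components of an eigenvector with respect to an invariant subspace and its complement are
eigenvectors. -/
theorem apply_eq_smul_of_add_of_mem_orthogonal (hU : ∀ a b x, U (a + b) x = U a (U b x))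
    {A : Submodule ℂ H} (hA : ∀ a, ∀ x ∈ A, U a x ∈ A) {x y : H} (hx : x ∈ A) (hy : y ∈ Aᗮ)
    {a : E} {c : ℂ} (h : U a (x + y) = c • (x + y)) : U a x = c • x ∧ U a y = c • y := by
  have key : U a x - c • x = c • y - U a y := by
    rw [map_add, smul_add] at h
    rw [sub_eq_sub_iff_add_eq_add, h, add_comm]
  have h1 : U a x - c • x ∈ A := A.sub_mem (hA _ _ hx) (A.smul_mem _ hx)
  have h2 : U a x - c • x ∈ Aᗮ := key ▸ Aᗮ.sub_mem (Aᗮ.smul_mem _ hy)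
    (apply_mem_orthogonal_of_forall_apply_mem hU hA a hy)
  have h0 : U a x - c • x = 0 := by
    simpa using Submodule.inner_right_of_mem_orthogonal h1 h2
  exact ⟨sub_eq_zero.1 h0, (sub_eq_zero.1 (key ▸ h0)).symm⟩

variable [Module ℝ E]

/-- The vectors on which `U` acts over the domain of `p` through the character `𝐞 ∘ p`. -/
noncomputable def jointEigenspace (U : E → H →ₗᵢ[ℂ] H) (p : E →ₗ.[ℝ] ℝ) : Submodule ℂ H where
  carrier := {f | ∀ w : p.domain, U w f = (𝐞 (p w) : ℂ) • f}
  add_mem' hf hg w := by rw [map_add, hf w, hg w, smul_add]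
  zero_mem' w := by rw [map_zero, smul_zero]
  smul_mem' c f hf w := by rw [map_smul, hf w, smul_comm]

/-- The part of the joint eigenspace orthogonal to the fixed vectors. -/
noncomputable def reducedEigenspace (U : E → H →ₗᵢ[ℂ] H) (p : E →ₗ.[ℝ] ℝ) : Submodule ℂ H :=
  jointEigenspace U p ⊓ (fixedSubspace U)ᗮ

theorem isClosed_reducedEigenspace (p : E →ₗ.[ℝ] ℝ) :
    IsClosed (reducedEigenspace U p : Set H) := by
  have : (jointEigenspace U p : Set H) = ⋂ w : p.domain, {f | U w f = (𝐞 (p w) : ℂ) • f} := by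
    ext f; simp [jointEigenspace]
  rw [reducedEigenspace, Submodule.coe_inf, this]
  exact (isClosed_iInter fun w : p.domain => isClosed_eq (U w).continuous
    (continuous_const_smul (𝐞 (p w) : ℂ))).inter
    (Submodule.isClosed_orthogonal _)

theorem apply_mem_reducedEigenspace (hU : ∀ a b x, U (a + b) x = U a (U b x)) (p : E →ₗ.[ℝ] ℝ)
    (a : E) {x : H} (hx : x ∈ reducedEigenspace U p) : U a x ∈ reducedEigenspace U p := by
  refine ⟨fun w => ?_, apply_mem_fixedSubspace_orthogonal hU a hx.2⟩
  rw [← hU, add_comm, hU, hx.1 w, map_smul]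

theorem apply_eq_apply_of_mem_jointEigenspace {p q : E →ₗ.[ℝ] ℝ} {f : H} (hf : f ≠ 0)
    (hp : f ∈ jointEigenspace U p) (hq : f ∈ jointEigenspace U q) (x : p.domain) (y : q.domain)
    (hxy : (x : E) = y) : p x = q y := by
  refine sub_eq_zero.1 (eq_zero_of_forall_fourierChar_mul_eq_one fun t => ?_)
  have h : (𝐞 (p (t • x)) : ℂ) • f = (𝐞 (q (t • y)) : ℂ) • f := by
    rw [← hp (t • x), ← hq (t • y), Submodule.coe_smul, Submodule.coe_smul, hxy]
  have h' : 𝐞 (p (t • x)) = 𝐞 (q (t • y)) := Circle.ext (smul_left_injective ℂ hf h)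
  rw [LinearPMap.map_smul, LinearPMap.map_smul, smul_eq_mul, smul_eq_mul] at h'
  rw [mul_sub, AddChar.map_sub_eq_div, h', div_self']

theorem mem_jointEigenspace_sup (hU : ∀ a b x, U (a + b) x = U a (U b x)) {p q : E →ₗ.[ℝ] ℝ}
    (h : ∀ (x : p.domain) (y : q.domain), (x : E) = y → p x = q y) {f : H}
    (hp : f ∈ jointEigenspace U p) (hq : f ∈ jointEigenspace U q) :
    f ∈ jointEigenspace U (p.sup q h) := by
  rintro ⟨w, hw⟩
  obtain ⟨x, hx, y, hy, rfl⟩ := Submodule.mem_sup.1 hw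
  have hval : p.sup q h ⟨x + y, hw⟩ = p ⟨x, hx⟩ + q ⟨y, hy⟩ := LinearPMap.sup_apply h _ _ _ rfl
  rw [hval, hU, hq ⟨y, hy⟩, map_smul, hp ⟨x, hx⟩, AddChar.map_add_eq_mul, Circle.coe_mul,
    smul_smul, mul_comm]

/-- Reduced eigenspaces of distinct partial functionals, each maximal with nonzero reduced
eigenspace, are orthogonal. -/
theorem reducedEigenspace_isOrtho_of_maximal [CompleteSpace H]
    (hU : ∀ a b x, U (a + b) x = U a (U b x)) {p q : E →ₗ.[ℝ] ℝ}
    (hp : Maximal (fun r => reducedEigenspace U r ≠ ⊥) p)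
    (hq : Maximal (fun r => reducedEigenspace U r ≠ ⊥) q) (hpq : p ≠ q) :
    reducedEigenspace U p ⟂ reducedEigenspace U q := by
  have hbot : reducedEigenspace U p ⊓ reducedEigenspace U q = ⊥ := by
    refine (Submodule.eq_bot_iff _).2 fun f hf => by_contra fun hf0 => hpq ?_
    have hc := apply_eq_apply_of_mem_jointEigenspace hf0 hf.1.1 hf.2.1
    have hs : reducedEigenspace U (p.sup q hc) ≠ ⊥ := fun h => hf0 <|
      (Submodule.eq_bot_iff _).1 h f ⟨mem_jointEigenspace_sup hU hc hf.1.1 hf.2.1, hf.1.2⟩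
    exact (hp.eq_of_le hs (LinearPMap.left_le_sup _ _ hc)).trans
      (hq.eq_of_le hs (LinearPMap.right_le_sup _ _ hc)).symm
  have := (isClosed_reducedEigenspace (U := U) p).completeSpace_coe
  rw [Submodule.isOrtho_comm, Submodule.isOrtho_iff_le]
  intro g hg
  obtain ⟨x, hx, y, hy, rfl⟩ := (reducedEigenspace U p).exists_add_mem_mem_orthogonal g
  have hxq : x ∈ reducedEigenspace U q :=
    ⟨fun w => (apply_eq_smul_of_add_of_mem_orthogonal hU
      (fun a x hx => apply_mem_reducedEigenspace hU p a hx) hx hy (hg.1 w)).1, hx.2⟩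
  have hx0 : x = 0 := (Submodule.eq_bot_iff _).1 hbot x ⟨hx, hxq⟩
  rwa [hx0, zero_add]

theorem countable_setOf_maximal [CompleteSpace H] [TopologicalSpace.SeparableSpace H]
    (hU : ∀ a b x, U (a + b) x = U a (U b x)) :
    {p : E →ₗ.[ℝ] ℝ | Maximal (fun r => reducedEigenspace U r ≠ ⊥) p}.Countable := by
  have hv : ∀ p : {p : E →ₗ.[ℝ] ℝ | Maximal (fun r => reducedEigenspace U r ≠ ⊥) p},
      ∃ v ∈ reducedEigenspace U p.1, ‖v‖ = 1 := fun p => by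
    obtain ⟨v, hv, hv0⟩ := Submodule.exists_mem_ne_zero_of_ne_bot
      (show Maximal (fun r => reducedEigenspace U r ≠ ⊥) p.1 from p.2).prop
    exact ⟨_, Submodule.smul_mem _ ((‖v‖⁻¹ : ℝ) : ℂ) hv, by simp [norm_smul, hv0]⟩
  choose v hv hv1 using hv
  refine Pairwise.countable_of_isOpen_disjoint (s := fun p => Metric.ball (v p) (1 / 2))
    (fun p q hpq => Metric.ball_disjoint_ball ?_) (fun p => Metric.isOpen_ball)
    fun p => ⟨v p, by simp⟩
  have hinner : inner ℂ (v p) (v q) = 0 := Submodule.isOrtho_iff_inner_eq.1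
    (reducedEigenspace_isOrtho_of_maximal hU p.2 q.2 (Subtype.coe_injective.ne hpq)) _ (hv p) _
    (hv q)
  have hsq := norm_sub_sq (𝕜 := ℂ) (v p) (v q)
  rw [hinner, hv1, hv1] at hsq
  norm_num at hsq
  rw [dist_eq_norm]
  nlinarith [norm_nonneg (v p - v q)]

theorem exists_maximal_of_reducedEigenspace_ne_bot [FiniteDimensional ℝ E] {p : E →ₗ.[ℝ] ℝ}
    (hp : reducedEigenspace U p ≠ ⊥) :
    ∃ q, p ≤ q ∧ Maximal (fun r => reducedEigenspace U r ≠ ⊥) q := by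
  obtain ⟨q, ⟨hpq, hq⟩, hmax⟩ := WellFounded.has_min
    (measure fun q : E →ₗ.[ℝ] ℝ => Module.finrank ℝ E - Module.finrank ℝ q.domain).wf
    {q | p ≤ q ∧ reducedEigenspace U q ≠ ⊥} ⟨p, le_rfl, hp⟩
  refine ⟨q, hpq, hq, fun r hr hqr => (LinearPMap.eq_of_le_of_domain_eq hqr ?_).ge⟩
  refine Submodule.eq_of_le_of_finrank_le hqr.1 ?_
  have h1 := hmax r ⟨hpq.trans hqr, hr⟩
  have h2 := Submodule.finrank_le r.domain
  have h3 := Submodule.finrank_le q.domain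
  simp only [InvImage, WellFoundedRelation.rel] at h1
  omega

/-- If the reduced eigenspace of `p` is nonzero, some nonzero functional takes an integer value
wherever `p` does. -/
theorem exists_ne_zero_functional {p : E →ₗ.[ℝ] ℝ} (hp : reducedEigenspace U p ≠ ⊥) :
    ∃ φ : E →ₗ[ℝ] ℝ, φ ≠ 0 ∧ ∀ (x : p.domain) (n : ℤ), p x = n → ∃ k : ℤ, φ x = k := by
  by_cases hd : p.domain = ⊤
  · let e : E →ₗ[ℝ] p.domain := LinearMap.codRestrict p.domain LinearMap.id fun x => hd ▸ trivial
    refine ⟨p.toFun ∘ₗ e, fun h0 => hp ?_, fun x n hx => ⟨n, hx⟩⟩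
    refine (Submodule.eq_bot_iff _).2 fun f hf => ?_
    have hfix : f ∈ fixedSubspace U := fun w => by
      have h1 := hf.1 (e w)
      have h2 : p (e w) = 0 := DFunLike.congr_fun h0 w
      rw [h2, AddChar.map_zero_eq_one, Circle.coe_one, one_smul] at h1
      exact h1
    simpa using Submodule.inner_right_of_mem_orthogonal hfix hf.2
  · obtain ⟨φ, hφ, hle⟩ := Submodule.exists_le_ker_of_lt_top p.domain (lt_top_iff_ne_top.2 hd)
    exact ⟨φ, hφ, fun x n _ => ⟨0, by simpa using hle x.2⟩⟩

/-- Weak integral over `[0, 1]` of a bounded weakly measurable Hilbert-space-valued function. -/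
theorem exists_inner_eq_intervalIntegral {H : Type*} [NormedAddCommGroup H]
    [InnerProductSpace ℂ H] [CompleteSpace H] {φ : ℝ → H}
    (hφ : ∀ g, Measurable fun t => inner ℂ (φ t) g) {C : ℝ} (hC : ∀ t, ‖φ t‖ ≤ C) :
    ∃ F : H, ∀ g, inner ℂ F g = ∫ t in (0 : ℝ)..1, inner ℂ (φ t) g := by
  have hbound : ∀ g t, ‖inner ℂ (φ t) g‖ ≤ C * ‖g‖ := fun g t =>
    (norm_inner_le_norm _ _).trans (mul_le_mul_of_nonneg_right (hC t) (norm_nonneg g))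
  have hint : ∀ g, IntervalIntegrable (fun t => inner ℂ (φ t) g) volume 0 1 := fun g =>
    (intervalIntegrable_const (c := C * ‖g‖)).mono_fun' (hφ g).aestronglyMeasurable
      (ae_of_all _ (hbound g))
  let l : H →ₗ[ℂ] ℂ :=
    { toFun := fun g => ∫ t in (0 : ℝ)..1, inner ℂ (φ t) g
      map_add' := fun g h => by
        simp_rw [inner_add_right]
        exact intervalIntegral.integral_add (hint g) (hint h)
      map_smul' := fun c g => by
        simp_rw [inner_smul_right]
        exact intervalIntegral.integral_const_mul _ _ }
  let L : H →L[ℂ] ℂ := l.mkContinuous C fun g => by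
    have h := intervalIntegral.norm_integral_le_of_norm_le_const (a := 0) (b := 1)
      fun t _ => hbound g t
    rwa [sub_zero, abs_one, mul_one] at h
  exact ⟨(InnerProductSpace.toDual ℂ H).symm L, fun g => InnerProductSpace.toDual_symm_apply⟩

/-- A nonzero vector fixed by `U a` and orthogonal to the vectors fixed by all of `U` yields a
nonzero reduced eigenspace for some partial functional taking an integer value at `a`. -/
theorem exists_reducedEigenspace_ne_bot [CompleteSpace H] [TopologicalSpace.SeparableSpace H]
    (hU : ∀ a b x, U (a + b) x = U a (U b x))
    (hmeas : ∀ (a : E) (x y : H), Measurable fun t : ℝ => inner ℂ (U (t • a) x) y)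
    {a : E} {f : H} (hf : f ≠ 0) (hfK : f ∈ (fixedSubspace U)ᗮ) (hfa : U a f = f) :
    ∃ p : E →ₗ.[ℝ] ℝ, reducedEigenspace U p ≠ ⊥ ∧
      ∃ x : p.domain, (x : E) = a ∧ ∃ n : ℤ, p x = n := by
  by_cases ha : a = 0
  · refine ⟨⊥, fun h => hf ((Submodule.eq_bot_iff _).1 h f ⟨fun w => ?_, hfK⟩), 0, ha.symm, 0, ?_⟩
    · have hw : w = 0 := Subtype.ext ((Submodule.mem_bot ℝ).1 w.2)
      rw [hw, LinearPMap.map_zero, Submodule.coe_zero, apply_zero_of_map_add hU,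
        AddChar.map_zero_eq_one, Circle.coe_one, one_smul]
    · rw [LinearPMap.map_zero, Int.cast_zero]
  have hmul : ∀ (n : ℤ) (t : ℝ) (g : H), inner ℂ ((𝐞 (-(n * t)) : ℂ) • U (t • a) f) g
      = (𝐞 (n * t) : ℂ) * inner ℂ (U (t • a) f) g := fun n t g => by
    rw [inner_smul_left, ← Circle.coe_inv_eq_conj, ← AddChar.map_neg_eq_inv, neg_neg]
  have hchar : ∀ n : ℤ, Measurable fun t : ℝ => (𝐞 (n * t) : ℂ) := fun n =>
    (continuous_subtype_val.comp (Real.continuous_fourierChar.comp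
      (continuous_const.mul continuous_id))).measurable
  have hF : ∀ n : ℤ, ∃ F : H, ∀ g,
      inner ℂ F g = ∫ t in (0 : ℝ)..1, (𝐞 (n * t) : ℂ) * inner ℂ (U (t • a) f) g := fun n => by
    simp_rw [← hmul]
    refine exists_inner_eq_intervalIntegral (C := ‖f‖) (fun g => ?_) fun t => ?_
    · simp_rw [hmul]
      exact (hchar n).mul (hmeas a f g)
    · rw [norm_smul, Circle.norm_coe, one_mul, LinearIsometry.norm_map]
  choose F hF using hF
  have hex : ∃ n, F n ≠ 0 := by
    by_contra! h0
    have hae : ∀ g, ∀ᵐ t ∂volume.restrict (Set.Ioc (0 : ℝ) 1), inner ℂ (U (t • a) f) g = 0 :=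
      fun g =>
      ae_eq_zero_of_forall_integral_fourierChar_eq_zero (hmeas a f g) (C := ‖f‖ * ‖g‖)
        (fun t => (norm_inner_le_norm _ _).trans (by rw [LinearIsometry.norm_map]))
        fun n => by rw [← hF, h0, inner_zero_left]
    have : (ae (volume.restrict (Set.Ioc (0 : ℝ) 1))).NeBot := by
      rw [ae_neBot, Ne, Measure.restrict_eq_zero]
      simp
    obtain ⟨t, ht⟩ := (ae_all_iff.2 fun k => hae (TopologicalSpace.denseSeq H k)).exists
    refine hf ((U (t • a)).injective ?_)
    rw [map_zero]
    refine (TopologicalSpace.denseRange_denseSeq H).eq_zero_of_inner_left ℂ ?_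
    exact ht
  obtain ⟨n, hn⟩ := hex
  have hper : ∀ g, Function.Periodic (fun t : ℝ => (𝐞 (n * t) : ℂ) * inner ℂ (U (t • a) f) g) 1 :=
    fun g t => by
      have h1 : 𝐞 ((n : ℝ) * (t + 1)) = 𝐞 (n * t) := by
        rw [mul_add, mul_one, AddChar.map_add_eq_mul]
        have : 𝐞 (n : ℝ) = 1 := Circle.ext (by
          rw [Real.fourierChar_apply, Circle.coe_one, Complex.exp_eq_one_iff]
          exact ⟨n, by push_cast; ring⟩)
        rw [this, mul_one]
      simp only [h1, add_smul, one_smul, hU, hfa]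
  have heig : ∀ s : ℝ, U (s • a) (F n) = (𝐞 (s * n) : ℂ) • F n := fun s => by
    refine ext_inner_right ℂ fun g => ?_
    have hshift : ∀ t : ℝ, (𝐞 (n * t) : ℂ) * inner ℂ (U (t • a) f) (U (-(s • a)) g)
        = (𝐞 (-(s * n)) : ℂ) * ((𝐞 (n * (t + s)) : ℂ) * inner ℂ (U ((t + s) • a) f) g) :=
      fun t => by
      rw [← inner_apply_left hU, ← hU, ← add_smul, add_comm s t, ← mul_assoc, ← Circle.coe_mul,
        ← AddChar.map_add_eq_mul]
      congr 4
      ring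
    rw [inner_apply_left hU, hF]
    simp_rw [hshift]
    rw [intervalIntegral.integral_const_mul, intervalIntegral.integral_comp_add_right
      (fun t => (𝐞 (n * t) : ℂ) * inner ℂ (U (t • a) f) g), zero_add, add_comm 1 s,
      (hper g).intervalIntegral_add_eq s 0, zero_add, ← hF, inner_smul_left,
      ← Circle.coe_inv_eq_conj, ← AddChar.map_neg_eq_inv]
  refine ⟨LinearPMap.mkSpanSingleton a (n : ℝ) ha, fun h => hn ?_,
    ⟨a, Submodule.mem_span_singleton_self a⟩, rfl, n, LinearPMap.mkSpanSingleton_apply ℝ ℝ ha _⟩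
  refine (Submodule.eq_bot_iff _).1 h _ ⟨?_, ?_⟩
  · rintro ⟨w, hw⟩
    obtain ⟨s, rfl⟩ := Submodule.mem_span_singleton.1 hw
    have hval : LinearPMap.mkSpanSingleton a (n : ℝ) ha ⟨s • a, hw⟩ = s * n :=
      LinearPMap.mkSpanSingleton'_apply _ _ _ _ _
    rw [hval]
    exact heig s
  · refine (Submodule.mem_orthogonal' _ _).2 fun g hg => ?_
    have h0 : ∀ t : ℝ, inner ℂ (U (t • a) f) g = 0 := fun t =>
      (Submodule.mem_orthogonal' _ _).1 (apply_mem_fixedSubspace_orthogonal hU _ hfK) g hg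
    simp [hF, h0]

/-- Off countably many level sets of nonzero functionals, every vector fixed by `U a` is fixed by
all of `U`. -/
theorem exists_countable_forall_mem_fixedSubspace [FiniteDimensional ℝ E] [CompleteSpace H]
    [TopologicalSpace.SeparableSpace H] (hU : ∀ a b x, U (a + b) x = U a (U b x))
    (hmeas : ∀ (a : E) (x y : H), Measurable fun t : ℝ => inner ℂ (U (t • a) x) y) :
    ∃ Φ : Set (E →ₗ[ℝ] ℝ), Φ.Countable ∧ (∀ φ ∈ Φ, φ ≠ 0) ∧
      ∀ a, (∀ φ ∈ Φ, ∀ n : ℤ, φ a ≠ n) → ∀ f, U a f = f → f ∈ fixedSubspace U := by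
  have hfun : ∀ p : {p : E →ₗ.[ℝ] ℝ | Maximal (fun r => reducedEigenspace U r ≠ ⊥) p},
      ∃ φ : E →ₗ[ℝ] ℝ, φ ≠ 0 ∧ ∀ (x : p.1.domain) (n : ℤ), p.1 x = n → ∃ k : ℤ, φ x = k :=
    fun p => exists_ne_zero_functional
      (show Maximal (fun r => reducedEigenspace U r ≠ ⊥) p.1 from p.2).prop
  choose φ hφ0 hφ using hfun
  have := (countable_setOf_maximal (E := E) hU).to_subtype
  refine ⟨Set.range φ, Set.countable_range φ, Set.forall_mem_range.2 hφ0, fun a ha f hfa => ?_⟩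
  have := (isClosed_fixedSubspace (U := U)).completeSpace_coe
  obtain ⟨f₀, hf₀, f₁, hf₁, rfl⟩ := (fixedSubspace U).exists_add_mem_mem_orthogonal f
  rw [map_add, hf₀ a, add_right_inj] at hfa
  suffices h : f₁ = 0 by rwa [h, add_zero]
  by_contra h0
  obtain ⟨p, hp, x, rfl, n, hn⟩ := exists_reducedEigenspace_ne_bot hU hmeas h0 hf₁ hfa
  obtain ⟨q, hpq, hq⟩ := exists_maximal_of_reducedEigenspace_ne_bot hp
  obtain ⟨k, hk⟩ := hφ ⟨q, hq⟩ ⟨x, hpq.1 x.2⟩ n ((hpq.2 rfl).symm.trans hn)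
  exact ha _ ⟨_, rfl⟩ k hk

end JointEigenspaces

theorem isHyperplane_setOf_apply_eq {m : ℕ} {φ : (Fin m → ℝ) →ₗ[ℝ] ℝ} (hφ : φ ≠ 0) (c : ℝ) :
    IsHyperplane m {x | φ x = c} := by
  obtain ⟨β, hβ⟩ := LinearMap.surjective hφ c
  refine ⟨LinearMap.ker φ, β, ?_, Set.ext fun x => ⟨fun hx => ⟨x - β, ?_, sub_add_cancel x β⟩, ?_⟩⟩
  · have h := LinearMap.finrank_range_add_finrank_ker φ
    rw [LinearMap.range_eq_top.2 (LinearMap.surjective hφ), finrank_top, Module.finrank_self,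
      Module.finrank_fin_fun] at h
    omega
  · have hx' : φ x = c := hx
    simp [hx', hβ]
  · rintro ⟨v, hv, rfl⟩
    have hv' : φ v = 0 := hv
    simp [hv', hβ]

namespace RSystem

variable {m : ℕ} {X : Type*} [MeasurableSpace X] {μ : Measure X}

/-- The Koopman representation on `L²`. -/
noncomputable def koopman (S : RSystem m X μ) (α : Fin m → ℝ) : Lp ℂ 2 μ →ₗᵢ[ℂ] Lp ℂ 2 μ :=
  Lp.compMeasurePreservingₗᵢ ℂ (S.T α) (S.measurePreserving α)

theorem koopman_add (S : RSystem m X μ) (α β : Fin m → ℝ) (f : Lp ℂ 2 μ) :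
    S.koopman (α + β) f = S.koopman α (S.koopman β f) := by
  have h : S.T (α + β) = S.T β ∘ S.T α := by rw [S.T_add, add_comm]
  have key : ∀ (g : X → X) (hg : MeasurePreserving g μ μ), g = S.T β ∘ S.T α →
      Lp.compMeasurePreserving g hg f = S.koopman α (S.koopman β f) := by
    rintro g hg rfl
    exact Lp.compMeasurePreserving_comp_apply f (S.measurePreserving β) (S.measurePreserving α)
  exact key _ (S.measurePreserving _) h

theorem measurable_inner_koopman_smul [SFinite μ] (S : RSystem m X μ) (α : Fin m → ℝ)
    (f g : Lp ℂ 2 μ) : Measurable fun t : ℝ => inner ℂ (S.koopman (t • α) f) g := by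
  have h : ∀ t : ℝ, inner ℂ (S.koopman (t • α) f) g
      = ∫ x, inner ℂ (f (S.T (t • α) x)) (g x) ∂μ := fun t => by
    rw [L2.inner_def]
    refine integral_congr_ae ?_
    filter_upwards [Lp.coeFn_compMeasurePreserving f (S.measurePreserving (t • α))] with x hx
    exact congrArg (fun z => inner ℂ z (g x)) hx
  simp_rw [h]
  have hT : Measurable fun p : ℝ × X => S.T (p.1 • α) p.2 :=
    S.measurable_pair.comp ((measurable_fst.smul_const α).prodMk measurable_snd)
  have hfg : StronglyMeasurable fun p : ℝ × X => inner ℂ (f (S.T (p.1 • α) p.2)) (g p.2) :=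
    ((Lp.stronglyMeasurable f).comp_measurable hT).inner
      ((Lp.stronglyMeasurable g).comp_measurable measurable_snd)
  exact hfg.integral_prod_right'.measurable

theorem koopman_indicatorConstLp_eq_iff [IsFiniteMeasure μ] (S : RSystem m X μ) {A : Set X}
    (hA : MeasurableSet A) (α : Fin m → ℝ) :
    S.koopman α (indicatorConstLp 2 hA (measure_ne_top μ A) 1)
        = indicatorConstLp 2 hA (measure_ne_top μ A) 1 ↔
      μ (symmDiff (S.T α ⁻¹' A) A) = 0 := by
  rw [measure_symmDiff_eq_zero_iff, ← indicatorConstLp_inj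
    (hA.preimage (S.measurePreserving α).measurable) (measure_ne_top _ _) hA (measure_ne_top μ A)
    (p := 2) (one_ne_zero (α := ℂ))]
  rfl

end RSystem

/-- For any `ℝ^m`-system, outside an at most countable union of
hyperplanes of `ℝ^m`, every direction `α` satisfies `I({nα : n ∈ ℤ}) = I(ℝ^m)`. -/
theorem invSets_int_orbit_eq_invSets_univ_off_countably_many_hyperplanes
    (m : ℕ) (X : Type) [MeasurableSpace X] (μ : Measure X) [IsProbabilityMeasure μ]
    (S : RSystem m X μ) :
    ∃ L : Set (Set (Fin m → ℝ)), L.Countable ∧ (∀ ℓ ∈ L, IsHyperplane m ℓ) ∧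
      ∀ α : Fin m → ℝ, α ∉ ⋃₀ L →
        S.InvSets (Set.range fun n : ℤ => (n : ℝ) • α) = S.InvSets Set.univ := by
  have := S.separableL2
  obtain ⟨Φ, hΦ, hΦ0, hfix⟩ := exists_countable_forall_mem_fixedSubspace S.koopman_add
    S.measurable_inner_koopman_smul
  refine ⟨Set.image2 (fun (φ : (Fin m → ℝ) →ₗ[ℝ] ℝ) (n : ℤ) => {x | φ x = (n : ℝ)}) Φ Set.univ,
    hΦ.image2 Set.countable_univ _, ?_, fun α hα => Set.Subset.antisymm ?_ ?_⟩
  · rintro _ ⟨φ, hφ, n, -, rfl⟩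
    exact isHyperplane_setOf_apply_eq (hΦ0 φ hφ) n
  · rintro A ⟨hA, hinv⟩
    refine ⟨hA, fun β _ => (S.koopman_indicatorConstLp_eq_iff hA β).1 (hfix α ?_ _ ?_ β)⟩
    · exact fun φ hφ n hn => hα ⟨_, ⟨φ, hφ, n, Set.mem_univ n, rfl⟩, hn⟩
    · exact (S.koopman_indicatorConstLp_eq_iff hA α).2 (hinv α ⟨1, by simp⟩)
  · exact fun A hA => ⟨hA.1, fun β _ => hA.2 β (Set.mem_univ β)⟩
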